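/- Let J be a prime ideal of ℬ[x] with x ∉ J, let 𝔄 = 𝔄_J = {a ≥ 1 : 1+x^a ∈ J}, and let d > 1 be an integer with d ∈ 𝔄 such that every element of the (nonempty) complement ℕ₊ \ 𝔄 is divisible by d and the set S = {n/d : n ∈ ℕ₊ \ 𝔄} has greatest common divisor 1. Let F be the largest positive integer not in S (the Frobenius number of S) and set A = (F+1)d. If 1+x^a+x^m ∈ J for every a ∈ 𝔄 with d ≤ a < A and every m ≥ 1, then J equals the ideal of ℬ[x] generated by {1+x^a+x^m : a ∈ 𝔄, m ≥ 0}. -/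

import Mathlib

/-- The Boolean semifield `𝔹 = {0, 1}` with `1 + 1 = 1`
    (addition is `∨`, multiplication is `∧`). -/
def BoolSemiring : Type := Bool

namespace BoolSemiring

instance : Zero BoolSemiring := ⟨(false : Bool)⟩
instance : One BoolSemiring := ⟨(true : Bool)⟩
instance : Add BoolSemiring := ⟨fun a b => ((a : Bool) || (b : Bool) : Bool)⟩
instance : Mul BoolSemiring := ⟨fun a b => ((a : Bool) && (b : Bool) : Bool)⟩
instance : DecidableEq BoolSemiring := fun a b => instDecidableEqBool a b
instance : Fintype BoolSemiring := Bool.fintype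

instance : CommSemiring BoolSemiring where
  add_assoc := by decide
  zero_add := by decide
  add_zero := by decide
  add_comm := by decide
  mul_assoc := by decide
  one_mul := by decide
  mul_one := by decide
  zero_mul := by decide
  mul_zero := by decide
  left_distrib := by decide
  right_distrib := by decide
  mul_comm := by decide
  nsmul := nsmulRec

end BoolSemiring

notation "𝔹" => BoolSemiring

open Polynomial

/-- The set `𝔄_J = {a ≥ 1 : 1 + x^a ∈ J}` associated to an ideal `J` of `𝔹[x]`. -/
def AJ (J : Ideal (Polynomial 𝔹)) : Set ℕ :=
  {a : ℕ | 1 ≤ a ∧ (1 : Polynomial 𝔹) + X ^ a ∈ J}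

namespace BoolSemiring

theorem add_ne_zero_iff : ∀ a b : 𝔹, a + b ≠ 0 ↔ a ≠ 0 ∨ b ≠ 0 := by decide

theorem eq_of_ne_zero_iff : ∀ a b : 𝔹, (a ≠ 0 ↔ b ≠ 0) → a = b := by decide

instance : Nontrivial 𝔹 := ⟨⟨0, 1, by decide⟩⟩

theorem mem_support_add {f g : 𝔹[X]} {z : ℕ} :
    z ∈ (f + g).support ↔ z ∈ f.support ∨ z ∈ g.support := by
  simp only [mem_support_iff, coeff_add]
  exact add_ne_zero_iff _ _

theorem eq_of_support_eq {f g : 𝔹[X]} (h : f.support = g.support) : f = g := by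
  ext n
  apply eq_of_ne_zero_iff
  rw [← mem_support_iff, ← mem_support_iff, h]

theorem mem_support_X_pow {n z : ℕ} : z ∈ (X ^ n : 𝔹[X]).support ↔ z = n := by
  rw [support_X_pow, Finset.mem_singleton]

theorem mem_support_one {z : ℕ} : z ∈ (1 : 𝔹[X]).support ↔ z = 0 := by
  rw [← pow_zero X, mem_support_X_pow]

theorem mem_support_trinomial {a m z : ℕ} :
    z ∈ (1 + X ^ a + X ^ m : 𝔹[X]).support ↔ (z = 0 ∨ z = a) ∨ z = m := by
  rw [mem_support_add, mem_support_add, mem_support_one, mem_support_X_pow, mem_support_X_pow]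

theorem X_pow_add_of_mem {f : 𝔹[X]} {n : ℕ} (h : n ∈ f.support) : X ^ n + f = f := by
  apply eq_of_support_eq
  ext z
  rw [mem_support_add, mem_support_X_pow]
  constructor
  · rintro (rfl | h') <;> assumption
  · exact Or.inr

theorem mem_support_mul {f g : 𝔹[X]} {z : ℕ} :
    z ∈ (f * g).support ↔ ∃ i ∈ f.support, ∃ j ∈ g.support, i + j = z := by
  constructor
  · intro h
    rw [mem_support_iff, coeff_mul] at h
    obtain ⟨⟨i, j⟩, hij, hne⟩ := Finset.exists_ne_zero_of_sum_ne_zero h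
    refine ⟨i, ?_, j, ?_, Finset.HasAntidiagonal.mem_antidiagonal.mp hij⟩
    · exact mem_support_iff.mpr (left_ne_zero_of_mul hne)
    · exact mem_support_iff.mpr (right_ne_zero_of_mul hne)
  · rintro ⟨i, hi, j, hj, rfl⟩
    rw [← X_pow_add_of_mem hi, ← X_pow_add_of_mem hj, add_mul, mul_add, ← pow_add,
      mem_support_add, mem_support_add, mem_support_X_pow]
    exact Or.inl (Or.inl rfl)

theorem zero_mem_support_mul {f g : 𝔹[X]} (hf : 0 ∈ f.support) (hg : 0 ∈ g.support) :
    0 ∈ (f * g).support :=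
  mem_support_mul.mpr ⟨0, hf, 0, hg, rfl⟩

theorem mul_mem_support_pow {f : 𝔹[X]} {a : ℕ} (ha : a ∈ f.support) (k : ℕ) :
    k * a ∈ (f ^ k).support := by
  induction k with
  | zero => simp
  | succ k ih => exact pow_succ f k ▸ mem_support_mul.mpr ⟨_, ih, a, ha, by ring⟩

theorem zero_mem_support_pow {f : 𝔹[X]} (hf : 0 ∈ f.support) (k : ℕ) :
    0 ∈ (f ^ k).support := by
  simpa using mul_mem_support_pow hf k

/-- Small exponents of `f ^ (k + 1)` already occur in `f ^ k`, since some summand is zero. -/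
theorem mem_support_pow_of_le {f : 𝔹[X]} (k : ℕ) :
    ∀ z ≤ k, z ∈ (f ^ (k + 1)).support → z ∈ (f ^ k).support := by
  induction k with
  | zero =>
    intro z hz _
    rw [pow_zero, mem_support_one]
    omega
  | succ k ih =>
    intro z hz h
    rw [pow_succ] at h
    obtain ⟨i, hi, j, hj, rfl⟩ := mem_support_mul.mp h
    rcases Nat.eq_zero_or_pos j with rfl | hpos
    · exact hi
    · rw [pow_succ]
      exact mem_support_mul.mpr ⟨i, ih i (by omega) hi, j, hj, rfl⟩

/-- A polynomial belongs to an ideal once each of its exponents occurs in a member of the ideal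
whose support is contained in its own. -/
theorem mem_of_cover (I : Ideal 𝔹[X]) (f : 𝔹[X])
    (h : ∀ z ∈ f.support, ∃ g ∈ I, z ∈ g.support ∧ g.support ⊆ f.support) : f ∈ I := by
  have key : ∀ s : Finset ℕ, s ⊆ f.support → ∃ g ∈ I, s ⊆ g.support ∧ g.support ⊆ f.support := by
    intro s
    induction s using Finset.induction_on with
    | empty => exact fun _ => ⟨0, I.zero_mem, by simp, by simp⟩
    | insert z s _ ih =>
      intro hs
      obtain ⟨g, hgI, hsg, hgf⟩ := ih fun y hy => hs (Finset.mem_insert_of_mem hy)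
      obtain ⟨g', hgI', hz, hgf'⟩ := h z (hs (Finset.mem_insert_self z s))
      refine ⟨g + g', I.add_mem hgI hgI', fun y hy => ?_, fun y hy => ?_⟩
      · rw [mem_support_add]
        rcases Finset.mem_insert.mp hy with rfl | hy
        · exact Or.inr hz
        · exact Or.inl (hsg hy)
      · rcases mem_support_add.mp hy with hy | hy
        · exact hgf hy
        · exact hgf' hy
  obtain ⟨g, hgI, h1, h2⟩ := key f.support subset_rfl
  rwa [eq_of_support_eq (h1.antisymm h2)]

theorem X_pow_mul_trinomial_support_subset {f : 𝔹[X]} {u a z : ℕ} (hu : u ∈ f.support)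
    (ha : u + a ∈ f.support) (hz : z ∈ f.support) (huz : u ≤ z) :
    z ∈ (X ^ u * (1 + X ^ a + X ^ (z - u)) : 𝔹[X]).support ∧
      (X ^ u * (1 + X ^ a + X ^ (z - u)) : 𝔹[X]).support ⊆ f.support := by
  constructor
  · exact mem_support_mul.mpr
      ⟨u, mem_support_X_pow.mpr rfl, z - u, mem_support_trinomial.mpr (Or.inr rfl), by omega⟩
  · intro y hy
    obtain ⟨i, hi, j, hj, rfl⟩ := mem_support_mul.mp hy
    rw [mem_support_X_pow] at hi
    subst hi
    rcases mem_support_trinomial.mp hj with (rfl | rfl) | rfl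
    · exact hu
    · exact ha
    · rwa [Nat.add_sub_cancel' huz]

theorem mem_of_trinomials (I : Ideal 𝔹[X]) {a : ℕ}
    (hI : ∀ m, (1 + X ^ a + X ^ m : 𝔹[X]) ∈ I) {f : 𝔹[X]} (h0 : 0 ∈ f.support)
    (ha : a ∈ f.support) : f ∈ I := by
  refine mem_of_cover I f fun z hz => ⟨X ^ 0 * (1 + X ^ a + X ^ (z - 0)),
    I.mul_mem_left _ (hI _), ?_⟩
  exact X_pow_mul_trinomial_support_subset h0 (by simpa using ha) hz (Nat.zero_le z)

theorem exists_X_pow_mul {f : 𝔹[X]} (hf : f ≠ 0) :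
    ∃ (u : ℕ) (g : 𝔹[X]), f = X ^ u * g ∧ 0 ∈ g.support := by
  have hu : f.natTrailingDegree ∈ f.support := natTrailingDegree_mem_support_of_nonzero hf
  have hdvd : X ^ f.natTrailingDegree ∣ f :=
    X_pow_dvd_iff.mpr fun k hk => coeff_eq_zero_of_lt_natTrailingDegree hk
  obtain ⟨g, hg⟩ := hdvd
  refine ⟨_, g, hg, ?_⟩
  rw [hg] at hu
  obtain ⟨i, hi, j, hj, hij⟩ := mem_support_mul.mp hu
  rw [mem_support_X_pow] at hi
  rw [hg] at hi
  have : j = 0 := by omega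
  exact this ▸ hj

theorem one_add_X_pow_zero : (1 + X ^ 0 : 𝔹[X]) = 1 := by
  apply eq_of_support_eq
  ext z
  simp only [mem_support_add, mem_support_X_pow, mem_support_one, or_self]

theorem trinomial_zero (a : ℕ) : (1 + X ^ a + X ^ 0 : 𝔹[X]) = 1 + X ^ a := by
  apply eq_of_support_eq
  ext z
  simp only [mem_support_add, mem_support_X_pow, mem_support_one]
  tauto

theorem mem_support_one_add_X_pow {n z : ℕ} :
    z ∈ (1 + X ^ n : 𝔹[X]).support ↔ z = 0 ∨ z = n := by
  rw [mem_support_add, mem_support_one, mem_support_X_pow]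

theorem zero_mem_support_prod (s : Finset ℕ) :
    0 ∈ (∏ n ∈ s, (1 + X ^ n : 𝔹[X])).support := by
  induction s using Finset.induction_on with
  | empty => simp
  | insert n s hn ih =>
    rw [Finset.prod_insert hn]
    exact zero_mem_support_mul (mem_support_one_add_X_pow.mpr (Or.inl rfl)) ih

theorem mem_support_prod {s : Finset ℕ} {n : ℕ} (hn : n ∈ s) :
    n ∈ (∏ n ∈ s, (1 + X ^ n : 𝔹[X])).support := by
  rw [← Finset.mul_prod_erase s _ hn]
  exact mem_support_mul.mpr
    ⟨n, mem_support_one_add_X_pow.mpr (Or.inr rfl), 0, zero_mem_support_prod _, by omega⟩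

/-- Modulo a prime ideal avoiding `1 + X ^ A` and `1 + X ^ (A + d)` and containing every
`1 + X ^ d + X ^ m`, only exponents below `A` have to be covered. -/
theorem mem_of_cover_below {J : Ideal 𝔹[X]} (hJ : J.IsPrime) {d A : ℕ}
    (hA : (1 + X ^ A : 𝔹[X]) ∉ J) (hAd : (1 + X ^ (A + d) : 𝔹[X]) ∉ J)
    (hd : ∀ m, (1 + X ^ d + X ^ m : 𝔹[X]) ∈ J)
    {f : 𝔹[X]} (h0 : 0 ∈ f.support)
    (h : ∀ z ∈ f.support, z < A → ∃ g ∈ J, z ∈ g.support ∧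
      g.support ⊆ (f * ((1 + X ^ A) * (1 + X ^ (A + d)))).support) : f ∈ J := by
  have hD : ((1 + X ^ A) * (1 + X ^ (A + d)) : 𝔹[X]) ∉ J := fun hmem =>
    (hJ.mem_or_mem hmem).elim hA hAd
  refine (hJ.mem_or_mem (mem_of_cover J _ fun z hz => ?_)).resolve_right hD
  rcases lt_or_ge z A with hzA | hzA
  · obtain ⟨i, hi, j, hj, rfl⟩ := mem_support_mul.mp hz
    obtain ⟨j₁, hj₁, j₂, hj₂, rfl⟩ := mem_support_mul.mp hj
    rw [mem_support_one_add_X_pow] at hj₁ hj₂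
    obtain rfl : j₁ = 0 := by omega
    obtain rfl : j₂ = 0 := by omega
    exact h i hi hzA
  · refine ⟨_, J.mul_mem_left (X ^ A) (hd (z - A)),
      X_pow_mul_trinomial_support_subset ?_ ?_ hz hzA⟩
    · exact mem_support_mul.mpr ⟨0, h0, A, mem_support_mul.mpr
        ⟨A, mem_support_one_add_X_pow.mpr (Or.inr rfl),
          0, mem_support_one_add_X_pow.mpr (Or.inl rfl), rfl⟩, by omega⟩
    · exact mem_support_mul.mpr ⟨0, h0, A + d, mem_support_mul.mpr
        ⟨0, mem_support_one_add_X_pow.mpr (Or.inl rfl),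
          A + d, mem_support_one_add_X_pow.mpr (Or.inr rfl), by omega⟩, by omega⟩

theorem exists_one_add_X_pow_mem {J : Ideal 𝔹[X]} (hJ : J.IsPrime) {d A : ℕ}
    (hA : (1 + X ^ A : 𝔹[X]) ∉ J) (hAd : (1 + X ^ (A + d) : 𝔹[X]) ∉ J)
    (hd : ∀ m, (1 + X ^ d + X ^ m : 𝔹[X]) ∈ J)
    {f : 𝔹[X]} (hf : f ∈ J) (h0 : 0 ∈ f.support) :
    ∃ n ∈ f.support, n ∈ AJ J := by
  by_contra! hcon
  set C : 𝔹[X] := ∏ n ∈ f.support, (1 + X ^ n) with hC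
  have hCJ : C ∉ J := by
    intro hmem
    obtain ⟨n, hn, hnJ⟩ := hJ.prod_mem_iff.mp hmem
    rcases Nat.eq_zero_or_pos n with rfl | hpos
    · rw [one_add_X_pow_zero] at hnJ
      exact hJ.ne_top ((Ideal.eq_top_iff_one J).mpr hnJ)
    · exact hcon n hn ⟨hpos, hnJ⟩
  have hC0 : 0 ∈ C.support := zero_mem_support_prod _
  refine hCJ (hJ.mem_of_pow_mem (A + 1) (mem_of_cover_below hJ hA hAd hd
    (zero_mem_support_pow hC0 _) fun z hz hzA => ⟨X ^ z * f, J.mul_mem_left _ hf, ?_, ?_⟩))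
  · exact mem_support_mul.mpr ⟨z, mem_support_X_pow.mpr rfl, 0, h0, rfl⟩
  · intro y hy
    obtain ⟨i, hi, j, hj, rfl⟩ := mem_support_mul.mp hy
    obtain rfl := mem_support_X_pow.mp hi
    refine mem_support_mul.mpr ⟨i + j, ?_, 0, zero_mem_support_mul
      (mem_support_one_add_X_pow.mpr (Or.inl rfl))
      (mem_support_one_add_X_pow.mpr (Or.inl rfl)), rfl⟩
    rw [pow_succ]
    exact mem_support_mul.mpr
      ⟨i, mem_support_pow_of_le A i hzA.le hz, j, mem_support_prod hj, rfl⟩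

theorem trinomial_mem_of_le {J : Ideal 𝔹[X]} (hJ : J.IsPrime) {d A : ℕ}
    (hA : (1 + X ^ A : 𝔹[X]) ∉ J) (hAd : (1 + X ^ (A + d) : 𝔹[X]) ∉ J)
    (hd : ∀ m, (1 + X ^ d + X ^ m : 𝔹[X]) ∈ J)
    {a m : ℕ} (ha : (1 + X ^ a : 𝔹[X]) ∈ J) (haA : A ≤ a)
    (hm : A ≤ m) : (1 + X ^ a + X ^ m : 𝔹[X]) ∈ J := by
  refine mem_of_cover_below hJ hA hAd hd (mem_support_trinomial.mpr (Or.inl (Or.inl rfl)))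
    fun z hz hzA => ⟨_, ha, ?_, fun y hy => ?_⟩
  · rcases mem_support_trinomial.mp hz with (rfl | rfl) | rfl
    · exact mem_support_one_add_X_pow.mpr (Or.inl rfl)
    · omega
    · omega
  · exact mem_support_mul.mpr ⟨y, mem_support_add.mpr (Or.inl hy), 0, zero_mem_support_mul
      (mem_support_one_add_X_pow.mpr (Or.inl rfl))
      (mem_support_one_add_X_pow.mpr (Or.inl rfl)), rfl⟩

end BoolSemiring

open BoolSemiring

theorem stmt_18 (J : Ideal (Polynomial 𝔹)) (hJ : J.IsPrime)
    (hx : (X : Polynomial 𝔹) ∉ J)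
    (d : ℕ) (hd : 1 < d) (hdA : d ∈ AJ J)
    (hne : {n : ℕ | 1 ≤ n ∧ n ∉ AJ J}.Nonempty)
    (hdvd : ∀ n : ℕ, 1 ≤ n → n ∉ AJ J → d ∣ n)
    (hgcd : ∀ k : ℕ, (∀ s : ℕ, 0 < s → s * d ∉ AJ J → k ∣ s) → k = 1)
    (F : ℕ) (hF0 : 0 < F) (hFnot : ¬ (0 < F ∧ F * d ∉ AJ J))
    (hFmax : ∀ s : ℕ, F < s → 0 < s ∧ s * d ∉ AJ J)
    (h : ∀ a ∈ AJ J, d ≤ a → a < (F + 1) * d →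
      ∀ m : ℕ, 1 ≤ m → (1 : Polynomial 𝔹) + X ^ a + X ^ m ∈ J) :
    J = Ideal.span {f : Polynomial 𝔹 | ∃ a ∈ AJ J, ∃ m : ℕ, f = 1 + X ^ a + X ^ m} := by
  have hA : (1 + X ^ ((F + 1) * d) : 𝔹[X]) ∉ J := fun hmem =>
    (hFmax (F + 1) (by omega)).2 ⟨Nat.mul_pos (by omega) (by omega), hmem⟩
  have hAd : (1 + X ^ ((F + 1) * d + d) : 𝔹[X]) ∉ J := fun hmem =>
    (hFmax (F + 2) (by omega)).2 ⟨Nat.mul_pos (by omega) (by omega),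
      by rwa [show (F + 2) * d = (F + 1) * d + d by ring]⟩
  have h2d : 2 * d ≤ (F + 1) * d := Nat.mul_le_mul_right d (by omega)
  have hmid : ∀ a ∈ AJ J, d ≤ a → a < (F + 1) * d → ∀ m, (1 + X ^ a + X ^ m : 𝔹[X]) ∈ J := by
    intro a ha had haA m
    rcases Nat.eq_zero_or_pos m with rfl | hm
    · rw [trinomial_zero]
      exact ha.2
    · exact h a ha had haA m hm
  have hdm := hmid d hdA le_rfl (by omega)
  have hlow : ∀ a ∈ AJ J, a < (F + 1) * d → ∀ m, (1 + X ^ a + X ^ m : 𝔹[X]) ∈ J := by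
    intro a ha haA m
    rcases le_or_gt d a with had | had
    · exact hmid a ha had haA m
    have hapos : 1 ≤ a := ha.1
    obtain ⟨k, hk1, hk2⟩ : ∃ k, d ≤ k * a ∧ k * a < 2 * d := by
      refine ⟨d / a + 1, ?_, ?_⟩
      · exact (Nat.lt_mul_of_div_lt (Nat.lt_succ_self _) hapos).le
      · have := Nat.div_mul_le_self d a
        rw [add_mul]
        omega
    have hka : k * a ∈ AJ J := by
      by_contra hcon
      obtain ⟨c, hc⟩ := hdvd _ (by omega) hcon
      have hc1 : 0 < c := by
        rcases Nat.eq_zero_or_pos c with rfl | hpos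
        · omega
        · exact hpos
      have hc2 : c < 2 := by
        by_contra! hge
        have := Nat.mul_le_mul_left d hge
        omega
      obtain rfl : c = 1 := by omega
      rw [hc, mul_one] at hcon
      exact hcon hdA
    exact hJ.mem_of_pow_mem k (mem_of_trinomials J (hmid _ hka hk1 (by omega))
      (zero_mem_support_pow (mem_support_trinomial.mpr (Or.inl (Or.inl rfl))) k)
      (mul_mem_support_pow (mem_support_trinomial.mpr (Or.inl (Or.inr rfl))) k))
  have hall : ∀ a ∈ AJ J, ∀ m, (1 + X ^ a + X ^ m : 𝔹[X]) ∈ J := by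
    intro a ha m
    rcases lt_or_ge a ((F + 1) * d) with haA | haA
    · exact hlow a ha haA m
    rcases le_or_gt ((F + 1) * d) m with hm | hm
    · exact trinomial_mem_of_le hJ hA hAd hdm ha.2 haA hm
    rcases Nat.eq_zero_or_pos m with rfl | hmpos
    · rw [trinomial_zero]
      exact ha.2
    by_cases hmA : m ∈ AJ J
    · rw [add_right_comm]
      exact hlow m hmA hm a
    have hda : ¬ d ∣ a := by
      rintro ⟨c, rfl⟩
      rw [mul_comm d c] at haA ha
      have : F + 1 ≤ c := Nat.le_of_mul_le_mul_right haA (by omega)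
      exact (hFmax c (by omega)).2 ha
    have ham : a - m ∈ AJ J := by
      by_contra hcon
      refine hda ?_
      have := Nat.dvd_add (hdvd _ (by omega) hcon) (hdvd m hmpos hmA)
      rwa [Nat.sub_add_cancel (by omega)] at this
    have hsum := J.add_mem ha.2 (J.mul_mem_left (X ^ m) ham.2)
    convert hsum using 1
    apply eq_of_support_eq
    ext z
    rw [mul_add, ← pow_add, mul_one, Nat.add_sub_cancel' (by omega)]
    simp only [mem_support_add, mem_support_X_pow, mem_support_one]
    tauto
  apply le_antisymm
  · intro f hf
    by_cases hf0 : f = 0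
    · rw [hf0]
      exact Ideal.zero_mem _
    obtain ⟨u, g, rfl, hg0⟩ := exists_X_pow_mul hf0
    have hgJ : g ∈ J := (hJ.mem_or_mem hf).resolve_left fun hX => hx (hJ.mem_of_pow_mem u hX)
    obtain ⟨a, hag, ha⟩ := exists_one_add_X_pow_mem hJ hA hAd hdm hgJ hg0
    exact Ideal.mul_mem_left _ _
      (mem_of_trinomials _ (fun m => Ideal.subset_span (Set.mem_ofPred_eq ▸ ⟨a, ha, m, rfl⟩)) hg0 hag)
  · rw [Ideal.span_le]
    rintro f ⟨a, ha, m, rfl⟩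
    exact hall a ha m
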